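/- Let $r_i, r_j, r_k > 0$ be positive real numbers and let $\Phi_{ij}, \Phi_{jk}, \Phi_{ik} \in [0, \pi/2]$ be edge weights. Define the edge lengths $l_{ij} = \sqrt{r_i^2 + r_j^2 + 2 r_i r_j \cos\Phi_{ij}}$, $l_{jk} = \sqrt{r_j^2 + r_k^2 + 2 r_j r_k \cos\Phi_{jk}}$, $l_{ik} = \sqrt{r_i^2 + r_k^2 + 2 r_i r_k \cos\Phi_{ik}}$. Then these three lengths satisfy the strict triangle inequalities: $l_{ij} < l_{jk} + l_{ik}$, $l_{jk} < l_{ij} + l_{ik}$, and $l_{ik} < l_{ij} + l_{jk}$. Consequently, the three lengths can be realized as the side lengths of a Euclidean triangle. -/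

import Mathlib

open Real

/-- The length of an edge joining circles of radii `a`, `b` with weight `φ` is at most `a + b`. -/
lemma sqrt_edge_le_add {a b : ℝ} (ha : 0 < a) (hb : 0 < b) (φ : ℝ) :
    √(a ^ 2 + b ^ 2 + 2 * a * b * cos φ) ≤ a + b := by
  refine (sqrt_le_left (by positivity)).2 ?_
  nlinarith [mul_le_mul_of_nonneg_left (cos_le_one φ) (mul_pos ha hb).le]

/-- A non-obtuse weight makes the edge longer than the radius at its first endpoint. -/
lemma left_lt_sqrt_edge {a b φ : ℝ} (ha : 0 < a) (hb : 0 < b) (hφ : φ ∈ Set.Icc 0 (π / 2)) :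
    a < √(a ^ 2 + b ^ 2 + 2 * a * b * cos φ) := by
  have hcos : 0 ≤ cos φ := cos_nonneg_of_mem_Icc ⟨by linarith [hφ.1, pi_pos], hφ.2⟩
  have hprod : 0 ≤ 2 * a * b * cos φ := by positivity
  exact lt_sqrt_of_sq_lt (by linarith [pow_pos hb 2])

/-- A non-obtuse weight makes the edge longer than the radius at its second endpoint. -/
lemma right_lt_sqrt_edge {a b φ : ℝ} (ha : 0 < a) (hb : 0 < b) (hφ : φ ∈ Set.Icc 0 (π / 2)) :
    b < √(a ^ 2 + b ^ 2 + 2 * a * b * cos φ) := by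
  have h := left_lt_sqrt_edge hb ha hφ
  rwa [show b ^ 2 + a ^ 2 + 2 * b * a * cos φ = a ^ 2 + b ^ 2 + 2 * a * b * cos φ by ring] at h

/-- Three lengths satisfying the triangle inequalities are the side lengths of a triangle in the
Euclidean plane. -/
lemma exists_triangle_of_sides {a b c : ℝ} (hc : 0 < c) (hab : c ≤ a + b) (hbc : a ≤ c + b)
    (hca : b ≤ c + a) :
    ∃ A B C : EuclideanSpace ℝ (Fin 2), dist A B = c ∧ dist B C = a ∧ dist A C = b := by
  have ha : 0 ≤ a := by linarith
  have hb : 0 ≤ b := by linarith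
  obtain ⟨x, hx⟩ : ∃ x : ℝ, 2 * c * x = b ^ 2 + c ^ 2 - a ^ 2 :=
    ⟨(b ^ 2 + c ^ 2 - a ^ 2) / (2 * c), by field_simp⟩
  have hxb : x ^ 2 ≤ b ^ 2 := by
    apply sq_le_sq'
    · nlinarith [mul_nonneg (sub_nonneg.2 hbc) (by linarith : 0 ≤ a + b + c)]
    · nlinarith [mul_nonneg (sub_nonneg.2 hab) (sub_nonneg.2 hca)]
  have hy : √(b ^ 2 - x ^ 2) ^ 2 = b ^ 2 - x ^ 2 := sq_sqrt (sub_nonneg.2 hxb)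
  refine ⟨!₂[0, 0], !₂[c, 0], !₂[x, √(b ^ 2 - x ^ 2)], ?_, ?_, ?_⟩ <;>
    simp only [EuclideanSpace.dist_eq, Fin.sum_univ_two, dist_eq, sq_abs] <;>
    simp only [Matrix.cons_val_zero, Matrix.cons_val_one]
  · rw [sqrt_eq_iff_mul_self_eq (by positivity) hc.le]
    ring
  · rw [sqrt_eq_iff_mul_self_eq (by positivity) ha]
    linarith
  · rw [sqrt_eq_iff_mul_self_eq (by positivity) hb]
    linarith

/-- Thurston's lemma: the edge lengths of a circle packing with weights in
`[0, π/2]` satisfy the strict triangle inequalities, hence are realized as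
the side lengths of a Euclidean triangle. -/
theorem thurston_triangle_inequality
    (ri rj rk : ℝ) (hri : 0 < ri) (hrj : 0 < rj) (hrk : 0 < rk)
    (Φij Φjk Φik : ℝ)
    (hΦij : Φij ∈ Set.Icc 0 (π / 2))
    (hΦjk : Φjk ∈ Set.Icc 0 (π / 2))
    (hΦik : Φik ∈ Set.Icc 0 (π / 2))
    (lij ljk lik : ℝ)
    (hlij : lij = Real.sqrt (ri ^ 2 + rj ^ 2 + 2 * ri * rj * Real.cos Φij))
    (hljk : ljk = Real.sqrt (rj ^ 2 + rk ^ 2 + 2 * rj * rk * Real.cos Φjk))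
    (hlik : lik = Real.sqrt (ri ^ 2 + rk ^ 2 + 2 * ri * rk * Real.cos Φik)) :
    (lij < ljk + lik ∧ ljk < lij + lik ∧ lik < lij + ljk) ∧
    ∃ A B C : EuclideanSpace ℝ (Fin 2),
      dist A B = lij ∧ dist B C = ljk ∧ dist A C = lik := by
  have hij := sqrt_edge_le_add hri hrj Φij
  have hjk := sqrt_edge_le_add hrj hrk Φjk
  have hik := sqrt_edge_le_add hri hrk Φik
  have hij_left := left_lt_sqrt_edge hri hrj hΦij
  have hij_right := right_lt_sqrt_edge hri hrj hΦij
  have hjk_left := left_lt_sqrt_edge hrj hrk hΦjk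
  have hjk_right := right_lt_sqrt_edge hrj hrk hΦjk
  have hik_left := left_lt_sqrt_edge hri hrk hΦik
  have hik_right := right_lt_sqrt_edge hri hrk hΦik
  rw [← hlij] at hij hij_left hij_right
  rw [← hljk] at hjk hjk_left hjk_right
  rw [← hlik] at hik hik_left hik_right
  exact ⟨⟨by linarith, by linarith, by linarith⟩,
    exists_triangle_of_sides (by linarith) (by linarith) (by linarith) (by linarith)⟩
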